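/- arXiv:1401.5868 — 2 statements merged into one kernel-verified Lean document; each statement's English description precedes it below -/
import Mathlib

section
/- Let n > 1 and k > 0 be integers. If H is an irreducible level k-matrix with n columns and m rows, then, as real numbers, m ≤ k^{n−1}·2^{−n}·(n+1)^{(n+1)/2}·((k+1)^n − k^n + 1). -/
/-- A matrix with nonnegative integer entries is *level* if all of its column sums are equal. -/
def IsLevel {m n : ℕ} (M : Matrix (Fin m) (Fin n) ℕ) : Prop :=
  ∀ j j' : Fin n, ∑ i, M i j = ∑ i, M i j'

/-- A level matrix is *reducible* if there is a nonempty proper subset of its row indices whose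
corresponding submatrix (keeping all columns) is level. -/
def IsReducible {m n : ℕ} (M : Matrix (Fin m) (Fin n) ℕ) : Prop :=
  ∃ S : Finset (Fin m), S.Nonempty ∧ S ≠ Finset.univ ∧
    ∀ j j' : Fin n, ∑ i ∈ S, M i j = ∑ i ∈ S, M i j'

/-- A level matrix is *irreducible* if it is level and not reducible. -/
def IsIrred {m n : ℕ} (M : Matrix (Fin m) (Fin n) ℕ) : Prop :=
  IsLevel M ∧ ¬ IsReducible M


lemma hadamard_bound (N : ℕ) (A : Matrix (Fin N) (Fin N) ℝ) (hA : ∀ i j, |A i j| ≤ 1) :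
    |A.det| ≤ (Real.sqrt N) ^ N := by
  have hf : Fact (Module.finrank ℝ (EuclideanSpace ℝ (Fin N)) = N) := ⟨by simp⟩
  let b := EuclideanSpace.basisFun (Fin N) ℝ
  let o : Orientation ℝ (EuclideanSpace ℝ (Fin N)) (Fin N) := b.toBasis.orientation
  let v : Fin N → EuclideanSpace ℝ (Fin N) := fun i => WithLp.toLp 2 (A i)
  have h1 := o.abs_volumeForm_apply_le v
  rw [o.volumeForm_robust' b] at h1
  have h2 : b.toBasis.det v = A.det := by
    rw [Module.Basis.det_apply, ← Matrix.det_transpose]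
    congr 1
  rw [h2] at h1
  refine h1.trans ?_
  calc ∏ i, ‖v i‖ ≤ ∏ i : Fin N, Real.sqrt N := by
        apply Finset.prod_le_prod
        · intro i _; positivity
        · intro i _
          rw [EuclideanSpace.norm_eq]
          apply Real.sqrt_le_sqrt
          calc ∑ j, ‖v i j‖ ^ 2 ≤ ∑ j : Fin N, (1:ℝ) := by
                apply Finset.sum_le_sum
                intro j _
                have := hA i j
                have h0 : 0 ≤ ‖v i j‖ := norm_nonneg _
                have : ‖v i j‖ ≤ 1 := this
                nlinarith
            _ = N := by simp
    _ = _ := by simp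

/-- Normal form of a row modulo the all-ones vector, with a leading `1`. -/
def psi {p : ℕ} (u : Fin (p + 1) → ℤ) : Fin (p + 1) → ℤ :=
  Fin.cons 1 (fun j => u j.succ - u 0)

lemma det_psi_bound (p k : ℕ) (hk : 0 < k) (U : Fin (p + 1) → Fin (p + 1) → ℤ)
    (hU : ∀ i j, 0 ≤ U i j ∧ U i j ≤ k) (B : Matrix (Fin (p + 1)) (Fin (p + 1)) ℝ)
    (hB : ∀ i j, B i j = (psi (U i) j : ℝ)) :
    |B.det| ≤ ((k : ℝ) / 2) ^ p * (Real.sqrt ((p + 2 : ℕ) : ℝ)) ^ (p + 2) := by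
  have hk' : (0 : ℝ) < k := by exact_mod_cast hk
  let s : Fin (p + 1) → Fin (p + 1) → ℝ := fun i j => 2 * (U i j : ℝ) / k - 1
  let W : Matrix (Fin (p + 2)) (Fin (p + 2)) ℝ := fun i =>
    Fin.cases (Fin.cons 1 (Fin.cons 0 (fun _ => 1)))
      (fun i' => Fin.cons (s i' 0) (Fin.cons 1 (fun j => s i' j.succ))) i
  let W' : Matrix (Fin (p + 2)) (Fin (p + 2)) ℝ := fun i =>
    Fin.cases (Fin.cons 1 (fun _ => 0))
      (fun i' => Fin.cons (s i' 0) (Fin.cons 1 (fun j => s i' j.succ - s i' 0))) i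
  let c : Fin (p + 2) → ℝ := Fin.cons 0 (Fin.cons 0 (fun _ => 1))
  have hdet : W.det = W'.det := by
    rw [← Matrix.det_transpose W, ← Matrix.det_transpose W']
    refine Matrix.det_eq_of_forall_row_eq_smul_add_const c 0 rfl ?_
    intro j i
    refine Fin.cases ?_ (fun j' => Fin.cases ?_ (fun j'' => ?_) j') j <;>
    refine Fin.cases ?_ (fun i' => ?_) i <;> simp only [Matrix.transpose_apply] <;> simp [W, W', c]
  have hs : ∀ i j, |s i j| ≤ 1 := by
    intro i j
    have h0 : (0 : ℝ) ≤ U i j := by exact_mod_cast (hU i j).1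
    have h1 : (U i j : ℝ) ≤ k := by exact_mod_cast (hU i j).2
    have h2 : 0 ≤ (U i j : ℝ) / k := by positivity
    have h3 : (U i j : ℝ) / k ≤ 1 := by rw [div_le_one hk']; exact h1
    have : s i j = 2 * ((U i j : ℝ) / k) - 1 := by simp only [s]; ring
    rw [this, abs_le]; constructor <;> linarith
  have hW : |W.det| ≤ _ := hadamard_bound (p + 2) W (by
    intro i j
    refine Fin.cases ?_ (fun j' => Fin.cases ?_ (fun j'' => ?_) j') j <;>
    refine Fin.cases ?_ (fun i' => ?_) i <;> simp [W, hs])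
  let d : Fin (p + 1) → ℝ := Fin.cons 1 (fun _ => 2 / (k:ℝ))
  have hW' : W'.det = (2 / (k:ℝ)) ^ p * B.det := by
    have h1 : (2 / (k:ℝ)) ^ p = ∏ j, d j := by rw [Fin.prod_univ_succ]; simp only [d, Fin.cons_zero, Fin.cons_succ, Finset.prod_const, Finset.card_univ, Fintype.card_fin, one_mul]
    rw [h1, ← Matrix.det_mul_row, Matrix.det_succ_row_zero, Fin.sum_univ_succ]
    have h2 : ∀ j : Fin (p+1), W' 0 j.succ = 0 := fun j => by simp [W']
    have h3 : W' 0 0 = 1 := by simp [W']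
    simp only [h2, h3]
    simp only [Fin.val_zero, pow_zero, mul_one, one_mul, mul_zero, zero_mul, Finset.sum_const_zero,
      add_zero]
    congr 1
    ext i j
    refine Fin.cases ?_ (fun j' => ?_) j
    · rw [Matrix.submatrix_apply]; simp [W', d, hB, psi]
    · rw [Matrix.submatrix_apply]; simp [W', d, hB, psi, s]; ring
  rw [hdet, hW', abs_mul, abs_of_pos (by positivity)] at hW
  calc |B.det| = (k/2:ℝ) ^ p * ((2 / (k:ℝ)) ^ p * |B.det|) := by
        rw [← mul_assoc, ← mul_pow]; field_simp; simp
    _ ≤ _ := by gcongr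

/-- Normal forms of the rows with entries in `[0,k]`. -/
def DD (p k : ℕ) : Set (Fin (p + 1) → ℤ) :=
  {v | ∃ u : Fin (p + 1) → ℤ, (∀ j, 0 ≤ u j ∧ u j ≤ k) ∧ psi u = v}

lemma DD_zero {p k : ℕ} {v : Fin (p + 1) → ℤ} (hv : v ∈ DD p k) : v 0 = 1 := by
  obtain ⟨u, -, rfl⟩ := hv
  simp [psi]

/-- Coordinatewise cast. -/
def cst {p : ℕ} (v : Fin (p + 1) → ℤ) : Fin (p + 1) → ℝ := fun j => (v j : ℝ)

lemma cst_inj {p : ℕ} : Function.Injective (cst (p := p)) := by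
  intro a b h
  ext j
  have := congrFun h j
  simpa [cst] using this

lemma span_DD (p k : ℕ) (hk : 0 < k) :
    Submodule.span ℝ (cst '' DD p k) = ⊤ := by
  rw [eq_top_iff, ← (Pi.basisFun ℝ (Fin (p + 1))).span_eq, Submodule.span_le]
  have h0 : (Pi.single 0 1 : Fin (p + 1) → ℝ) ∈ Submodule.span ℝ (cst '' DD p k) := by
    apply Submodule.subset_span
    refine ⟨psi 0, ⟨0, by simp, rfl⟩, ?_⟩
    ext j
    refine Fin.cases ?_ (fun j' => ?_) j <;> simp [cst, psi]
  rintro _ ⟨j, rfl⟩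
  rw [Pi.basisFun_apply]
  refine Fin.cases h0 (fun j' => ?_) j
  have h1 : cst (psi (Pi.single j'.succ 1)) ∈ Submodule.span ℝ (cst '' DD p k) := by
    apply Submodule.subset_span
    refine ⟨_, ⟨Pi.single j'.succ 1, ?_, rfl⟩, rfl⟩
    intro i
    by_cases h : i = j'.succ
    · subst h; simp; omega
    · simp [h]
  have h2 := Submodule.sub_mem _ h1 h0
  have h3 : (Pi.single j'.succ 1 : Fin (p + 1) → ℝ) =
      cst (psi (Pi.single j'.succ 1)) - Pi.single 0 1 := by
    ext i
    refine Fin.cases ?_ (fun i' => ?_) i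
    · simp [cst, psi]
    · by_cases h : i' = j'
      · subst h; simp [cst, psi]
      · simp [cst, psi, Pi.single_apply, h]
  rw [h3]
  exact h2

lemma exists_basis (p k : ℕ) (hk : 0 < k) (S : Finset (Fin (p + 1) → ℤ)) (hS : ↑S ⊆ DD p k)
    (hne : S.Nonempty) (y : (Fin (p + 1) → ℤ) → ℝ) (hy : ∀ v ∈ S, 0 < y v)
    (hrel : ∀ j : Fin p, ∑ v ∈ S, y v * (v j.succ : ℝ) = 0) :
    ∃ (B : Matrix (Fin (p + 1)) (Fin (p + 1)) ℤ) (W : Fin (p + 1) → ℝ),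
      (∀ i, B i ∈ DD p k) ∧ (B.map (Int.cast : ℤ → ℝ)).det ≠ 0 ∧ (∀ i, 0 ≤ W i) ∧
      (∀ i, W i ≠ 0 → B i ∈ S) ∧
      (∀ j, ∑ i, W i * (B i j : ℝ) = if j = 0 then 1 else 0) := by
  classical
  have hpos : 0 < ∑ v ∈ S, y v := Finset.sum_pos hy hne
  have hmem : (Pi.single 0 1 : Fin (p + 1) → ℝ) ∈ convexHull ℝ (cst '' (S : Set (Fin (p + 1) → ℤ))) := by
    have : (Pi.single 0 1 : Fin (p + 1) → ℝ) = S.centerMass y cst := by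
      rw [Finset.centerMass]
      ext j
      simp only [Pi.smul_apply, Finset.sum_apply, smul_eq_mul]
      refine Fin.cases ?_ (fun j' => ?_) j
      · have : ∀ v ∈ S, y v * cst v 0 = y v := by
          intro v hv
          simp [cst, DD_zero (hS hv)]
        rw [Finset.sum_congr rfl this, inv_mul_cancel₀ hpos.ne']; simp
      · have := hrel j'
        simp only [cst]
        rw [this]; simp
    rw [this]
    exact Finset.centerMass_mem_convexHull _ (fun v hv => (hy v hv).le) hpos
      (fun v hv => ⟨v, hv, rfl⟩)
  obtain ⟨ι, _, z, w, hz, haff, hw, hw1, hwz⟩ := eq_pos_convex_span_of_mem_convexHull hmem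
  have hz0 : ∀ i, z i 0 = 1 := by
    intro i
    obtain ⟨v, hv, hvz⟩ := hz ⟨i, rfl⟩
    rw [← hvz]; simp [cst, DD_zero (hS hv)]
  have hlin : LinearIndependent ℝ z := by
    rw [affineIndependent_iff] at haff
    rw [linearIndependent_iff']
    intro s g hg
    refine haff s g ?_ hg
    have := congrFun hg 0
    simpa [Finset.sum_apply, hz0] using this
  have hzD : Set.range z ⊆ cst '' DD p k := hz.trans (Set.image_mono hS)
  obtain ⟨b, hbD, hzb, hspan, hli⟩ := exists_linearIndepOn_id_extension hlin.linearIndepOn_id hzD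
  have hli' : LinearIndependent ℝ ((↑) : b → (Fin (p + 1) → ℝ)) := hli
  have htop : ⊤ ≤ Submodule.span ℝ (Set.range ((↑) : b → (Fin (p + 1) → ℝ))) := by
    rw [Subtype.range_coe, ← span_DD p k hk]
    exact Submodule.span_le.2 hspan
  let bas := Module.Basis.mk hli' htop
  have : Fintype b := FiniteDimensional.fintypeBasisIndex bas
  have hcard : Fintype.card (Fin (p + 1)) = Fintype.card b := by
    rw [← Module.finrank_eq_card_basis bas]; simp
  let e : Fin (p + 1) ≃ b := Fintype.equivOfCardEq hcard
  have hch : ∀ i, ∃ v, v ∈ DD p k ∧ cst v = (e i : Fin (p + 1) → ℝ) := fun i => hbD (e i).2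
  choose B hB hBe using hch
  let t : ι → Fin (p + 1) := fun a => e.symm ⟨z a, hzb ⟨a, rfl⟩⟩
  have ht : ∀ a, cst (B (t a)) = z a := by
    intro a; rw [hBe]; simp [t]
  refine ⟨B, fun i => ∑ a, if t a = i then w a else 0, hB, ?_, ?_, ?_, ?_⟩
  · have h1 : LinearIndependent ℝ (Matrix.row (Matrix.map B (Int.cast : ℤ → ℝ))) := by
      have h2 : (Matrix.row (Matrix.map B (Int.cast : ℤ → ℝ))) = (fun x : b => (x : Fin (p + 1) → ℝ)) ∘ e := by
        funext i
        simp only [Function.comp]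
        rw [← hBe]; rfl
      rw [h2]
      exact hli'.comp _ e.injective
    rw [Matrix.linearIndependent_rows_iff_isUnit, Matrix.isUnit_iff_isUnit_det] at h1
    exact h1.ne_zero
  · intro i
    refine Finset.sum_nonneg fun a _ => ?_
    split_ifs
    · exact (hw a).le
    · exact le_rfl
  · intro i hi
    obtain ⟨a, -, ha⟩ := Finset.exists_ne_zero_of_sum_ne_zero hi
    have hta : t a = i := by
      by_contra h; simp [h] at ha
    obtain ⟨v, hv, hvz⟩ := hz ⟨a, rfl⟩
    have : B i = v := by
      apply cst_inj
      rw [← hta, ht, hvz]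
    rw [this]; exact hv
  · intro j
    have h1 := congrFun hwz j
    simp only [Finset.sum_apply, Pi.smul_apply, smul_eq_mul, Pi.single_apply] at h1
    rw [← h1]
    simp only [Finset.sum_mul]
    rw [Finset.sum_comm]
    refine Finset.sum_congr rfl fun a _ => ?_
    simp only [ite_mul, zero_mul, Finset.sum_ite_eq, Finset.mem_univ, if_true]
    rw [← ht]; rfl

lemma exists_circuit (p k : ℕ) (hk : 0 < k) (S : Finset (Fin (p + 1) → ℤ)) (hS : ↑S ⊆ DD p k)
    (hne : S.Nonempty) (y : (Fin (p + 1) → ℤ) → ℝ) (hy : ∀ v ∈ S, 0 < y v)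
    (hrel : ∀ j : Fin p, ∑ v ∈ S, y v * (v j.succ : ℝ) = 0) :
    ∃ r : (Fin (p + 1) → ℤ) → ℕ, (∀ v, r v ≠ 0 → v ∈ S) ∧ (∃ v ∈ S, r v ≠ 0) ∧
      (∀ j : Fin p, ∑ v ∈ S, (r v : ℝ) * (v j.succ : ℝ) = 0) ∧
      ∑ v ∈ S, (r v : ℝ) ≤ ((k : ℝ) / 2) ^ p * (Real.sqrt ((p + 2 : ℕ) : ℝ)) ^ (p + 2) := by
  classical
  obtain ⟨B, W, hB, hdet, hW, hWS, hBW⟩ := exists_basis p k hk S hS hne y hy hrel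
  set BR : Matrix (Fin (p + 1)) (Fin (p + 1)) ℝ := B.map (Int.cast : ℤ → ℝ) with hBR
  have hsol : Matrix.vecMul W BR = Pi.single 0 1 := by
    ext j
    have := hBW j
    simp only [Matrix.vecMul, dotProduct, hBR, Matrix.map_apply, Pi.single_apply]
    exact this
  have hadj : ∀ i, BR.det * W i = ((B.adjugate 0 i : ℤ) : ℝ) := by
    intro i
    have h1 : Matrix.vecMul (Matrix.vecMul W BR) BR.adjugate = BR.det • W := by
      rw [Matrix.vecMul_vecMul, Matrix.mul_adjugate, Matrix.vecMul_smul, Matrix.vecMul_one]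
    rw [hsol] at h1
    have h2 := congrFun h1 i
    simp only [Matrix.single_one_vecMul, Pi.smul_apply, smul_eq_mul, Matrix.row_apply] at h2
    rw [← h2]
    have h3 : BR.adjugate = B.adjugate.map (Int.cast : ℤ → ℝ) := by
      have := (RingHom.map_adjugate (Int.castRingHom ℝ) B)
      exact this.symm
    rw [h3]; simp
  let c : Fin (p + 1) → ℕ := fun i => (B.adjugate 0 i).natAbs
  have hc : ∀ i, (c i : ℝ) = |BR.det| * W i := by
    intro i
    simp only [c]
    rw [Nat.cast_natAbs, Int.cast_abs, ← hadj, abs_mul, abs_of_nonneg (hW i)]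
  have hcS : ∀ i, c i ≠ 0 → B i ∈ S := by
    intro i hi
    apply hWS
    intro h
    apply hi
    have := hc i
    rw [h, mul_zero] at this
    exact_mod_cast this
  let r : (Fin (p + 1) → ℤ) → ℕ := fun v => ∑ i, if B i = v then c i else 0
  have hsum : ∀ f : (Fin (p + 1) → ℤ) → ℝ, ∑ v ∈ S, (r v : ℝ) * f v = ∑ i, (c i : ℝ) * f (B i) := by
    intro f
    simp only [r]
    push_cast
    simp only [Finset.sum_mul]
    rw [Finset.sum_comm]
    refine Finset.sum_congr rfl fun i _ => ?_
    simp only [ite_mul, zero_mul, Finset.sum_ite_eq]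
    split_ifs with h
    · rfl
    · have : c i = 0 := by
        by_contra h'
        exact h (hcS i h')
      simp [this]
  have hone : ∑ v ∈ S, (r v : ℝ) = |BR.det| := by
    have h1 := hsum (fun _ => 1)
    simp only [mul_one] at h1
    rw [h1]
    have h2 := hBW 0
    have h3 : ∀ i, W i * (B i 0 : ℝ) = W i := by
      intro i; simp [DD_zero (hB i)]
    simp only [h3, if_true] at h2
    simp only [hc]
    rw [← Finset.mul_sum, h2, mul_one]
  refine ⟨r, ?_, ?_, ?_, ?_⟩
  · intro v hv
    obtain ⟨i, -, hi⟩ := Finset.exists_ne_zero_of_sum_ne_zero hv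
    by_cases h : B i = v
    · simp only [h, if_true] at hi
      rw [← h]; exact hcS i hi
    · simp [h] at hi
  · by_contra! h
    have : ∑ v ∈ S, (r v : ℝ) = 0 := Finset.sum_eq_zero fun v hv => by simp [h v hv]
    rw [hone] at this
    exact hdet (abs_eq_zero.1 this)
  · intro j
    rw [hsum (fun v => (v j.succ : ℝ))]
    have := hBW j.succ
    simp only [hc, mul_assoc]
    rw [← Finset.mul_sum, this]
    simp [Fin.succ_ne_zero]
  · rw [hone]
    have hB' : ∀ i, ∃ u : Fin (p + 1) → ℤ, (∀ j, 0 ≤ u j ∧ u j ≤ k) ∧ psi u = B i := hB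
    choose U hU hUB using hB'
    exact det_psi_bound p k hk U hU BR (fun i j => by rw [hUB, hBR]; rfl)

lemma total_bound (p k : ℕ) (hk : 0 < k) (T : Finset (Fin (p + 1) → ℤ)) (hT : ↑T ⊆ DD p k)
    (x : (Fin (p + 1) → ℤ) → ℕ)
    (hirr : ∀ r : (Fin (p + 1) → ℤ) → ℕ, (∀ v ∈ T, r v ≤ x v) → (∃ v ∈ T, r v ≠ 0) →
      (∀ j : Fin p, ∑ v ∈ T, (r v : ℝ) * (v j.succ : ℝ) = 0) →
      ∑ v ∈ T, (x v : ℝ) ≤ ∑ v ∈ T, (r v : ℝ)) (s : ℕ) :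
    ∀ (y : (Fin (p + 1) → ℤ) → ℝ), (∀ v ∈ T, 0 ≤ y v) → (∀ v ∈ T, y v ≤ x v) →
      (∀ j : Fin p, ∑ v ∈ T, y v * (v j.succ : ℝ) = 0) →
      (T.filter (fun v => y v ≠ 0)).card ≤ s →
      ∑ v ∈ T, y v ≤ (((k : ℝ) / 2) ^ p * (Real.sqrt ((p + 2 : ℕ) : ℝ)) ^ (p + 2)) * s := by
  classical
  set M : ℝ := ((k : ℝ) / 2) ^ p * (Real.sqrt ((p + 2 : ℕ) : ℝ)) ^ (p + 2) with hM
  have hM0 : 0 ≤ M := by positivity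
  induction s with
  | zero =>
    intro y h0 hx hrel hcard
    have : ∀ v ∈ T, y v = 0 := by
      intro v hv
      by_contra h
      have : v ∈ T.filter (fun v => y v ≠ 0) := Finset.mem_filter.2 ⟨hv, h⟩
      have := Finset.card_pos.2 ⟨v, this⟩
      omega
    rw [Finset.sum_eq_zero this]; simp
  | succ s ih =>
    intro y h0 hx hrel hcard
    set S := T.filter (fun v => y v ≠ 0) with hSdef
    have hST : S ⊆ T := Finset.filter_subset _ _
    rcases S.eq_empty_or_nonempty with hemp | hne
    · refine (ih y h0 hx hrel (by rw [← hSdef, hemp]; simp)).trans ?_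
      push_cast; nlinarith
    have hSy : ∀ v ∈ S, 0 < y v := fun v hv =>
      lt_of_le_of_ne (h0 v (hST hv)) (Finset.mem_filter.1 hv).2.symm
    have hrelS : ∀ j : Fin p, ∑ v ∈ S, y v * (v j.succ : ℝ) = 0 := by
      intro j
      rw [← hrel j]
      refine Finset.sum_subset hST fun v hv hvS => ?_
      have : y v = 0 := by
        by_contra h; exact hvS (Finset.mem_filter.2 ⟨hv, h⟩)
      simp [this]
    obtain ⟨r, hrS, ⟨v₀, hv₀, hrv₀⟩, hrrel, hrM⟩ :=
      exists_circuit p k hk S (fun v hv => hT (hST hv)) hne y hSy hrelS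
    have hsumT : ∀ f : (Fin (p + 1) → ℤ) → ℝ,
        ∑ v ∈ T, (r v : ℝ) * f v = ∑ v ∈ S, (r v : ℝ) * f v := by
      intro f
      symm
      refine Finset.sum_subset hST fun v hv hvS => ?_
      have : r v = 0 := by by_contra h; exact hvS (hrS v h)
      simp [this]
    have hrT : ∑ v ∈ T, (r v : ℝ) ≤ M := by
      have := hsumT (fun _ => 1)
      simp only [mul_one] at this
      rw [this]; exact hrM
    have hrrelT : ∀ j : Fin p, ∑ v ∈ T, (r v : ℝ) * (v j.succ : ℝ) = 0 := by
      intro j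
      rw [hsumT (fun v => (v j.succ : ℝ))]; exact hrrel j
    let R := T.filter (fun v => r v ≠ 0)
    have hRne : R.Nonempty := ⟨v₀, Finset.mem_filter.2 ⟨hST hv₀, hrv₀⟩⟩
    obtain ⟨v₁, hv₁, hmin⟩ := R.exists_min_image (fun v => y v / r v) hRne
    obtain ⟨hv₁T, hrv₁⟩ := Finset.mem_filter.1 hv₁
    set lam : ℝ := y v₁ / r v₁ with hlam
    have hlam0 : 0 ≤ lam := div_nonneg (h0 _ hv₁T) (by positivity)
    have hle : ∀ v ∈ T, lam * r v ≤ y v := by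
      intro v hv
      by_cases h : r v = 0
      · simp [h, h0 v hv]
      · have h1 := hmin v (Finset.mem_filter.2 ⟨hv, h⟩)
        have h2 : (0 : ℝ) < r v := by positivity
        exact (le_div_iff₀ h2).1 h1
    have heq : lam * r v₁ = y v₁ := by
      rw [hlam]; field_simp
    by_cases h1 : 1 ≤ lam
    · have hrx : ∀ v ∈ T, r v ≤ x v := by
        intro v hv
        have h2 := hle v hv
        have h3 := hx v hv
        have h4 : (0 : ℝ) ≤ r v := by positivity
        have : (r v : ℝ) ≤ x v := by nlinarith
        exact_mod_cast this
      have h2 := hirr r hrx ⟨v₀, hST hv₀, hrv₀⟩ hrrelT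
      have h3 : ∑ v ∈ T, y v ≤ ∑ v ∈ T, (x v : ℝ) := Finset.sum_le_sum hx
      push_cast
      have : (0 : ℝ) ≤ s := by positivity
      nlinarith
    · push Not at h1
      have hstep := ih (fun v => y v - lam * r v) (fun v hv => by have := hle v hv; linarith)
        (fun v hv => by
          have := hx v hv
          have : 0 ≤ lam * r v := by positivity
          linarith)
        (by
          intro j
          simp only [sub_mul, Finset.sum_sub_distrib, mul_assoc]
          rw [hrel j, ← Finset.mul_sum, hrrelT j]; simp)
        (by
          have hss : T.filter (fun v => y v - lam * r v ≠ 0) ⊆ S.erase v₁ := by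
            intro v hv
            obtain ⟨hvT, hv2⟩ := Finset.mem_filter.1 hv
            rw [Finset.mem_erase]
            refine ⟨?_, Finset.mem_filter.2 ⟨hvT, ?_⟩⟩
            · rintro rfl; apply hv2; rw [heq]; simp
            · intro hy0
              have h5 : r v = 0 := by
                by_contra h
                exact (Finset.mem_filter.1 (hrS v h)).2 hy0
              apply hv2; simp [hy0, h5]
          have h6 := Finset.card_le_card hss
          rw [Finset.card_erase_of_mem (hrS v₁ hrv₁)] at h6
          omega)
      rw [Finset.sum_sub_distrib, ← Finset.mul_sum] at hstep
      have h7 : 0 ≤ ∑ v ∈ T, (r v : ℝ) := by positivity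
      push_cast
      nlinarith

lemma DD_finset (p k : ℕ) : ∃ D : Finset (Fin (p + 1) → ℤ), DD p k ⊆ ↑D ∧
    (D.card : ℝ) ≤ ((k : ℝ) + 1) ^ (p + 1) - (k : ℝ) ^ (p + 1) := by
  classical
  let F : Finset (Fin (p + 1) → ℤ) := Fintype.piFinset fun _ => Finset.Icc (0 : ℤ) k
  let G : Finset (Fin (p + 1) → ℤ) := Fintype.piFinset fun _ => Finset.Icc (1 : ℤ) k
  have hGF : G ⊆ F := by
    intro u hu
    simp only [F, G, Fintype.mem_piFinset, Finset.mem_Icc] at hu ⊢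
    intro a
    have := hu a
    omega
  refine ⟨(F \ G).image psi, ?_, ?_⟩
  · rintro v ⟨u, hu, rfl⟩
    obtain ⟨a, -, ha⟩ := Finset.exists_min_image (Finset.univ : Finset (Fin (p + 1))) u
      Finset.univ_nonempty
    rw [Finset.mem_coe, Finset.mem_image]
    refine ⟨fun j => u j - u a, ?_, ?_⟩
    · rw [Finset.mem_sdiff]
      simp only [F, G, Fintype.mem_piFinset, Finset.mem_Icc]
      constructor
      · intro j
        have := ha j (Finset.mem_univ _)
        have := hu j
        have := hu a
        omega
      · intro h
        have := h a
        omega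
    · funext j
      refine Fin.cases ?_ (fun j' => ?_) j <;> simp [psi]
  · have h1 : ((F \ G).image psi).card ≤ (F \ G).card := Finset.card_image_le
    rw [Finset.card_sdiff_of_subset hGF] at h1
    have h2 : F.card = (k + 1) ^ (p + 1) := by simp [F, Fintype.card_piFinset]
    have h3 : G.card = k ^ (p + 1) := by simp [G, Fintype.card_piFinset]
    have h4 := Finset.card_le_card hGF
    have h5 : ((F \ G).image psi).card + G.card ≤ F.card := by omega
    rw [h2, h3] at h5
    have : ((((F \ G).image psi).card + k ^ (p + 1) : ℕ) : ℝ) ≤ ((k + 1) ^ (p + 1) : ℕ) := by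
      exact_mod_cast h5
    push_cast at this
    linarith

lemma irred_eq_univ {m n : ℕ} {H : Matrix (Fin m) (Fin n) ℕ} (hH : IsIrred H)
    (S : Finset (Fin m)) (hS : S.Nonempty)
    (hl : ∀ j j' : Fin n, ∑ i ∈ S, H i j = ∑ i ∈ S, H i j') : S = Finset.univ := by
  by_contra h
  exact hH.2 ⟨S, hS, h, hl⟩

lemma level_of_succ {m p : ℕ} (H : Matrix (Fin m) (Fin (p + 1)) ℕ) (S : Finset (Fin m))
    (h : ∀ j : Fin p, ∑ i ∈ S, ((H i j.succ : ℤ) - (H i 0 : ℤ)) = 0) (j j' : Fin (p + 1)) :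
    ∑ i ∈ S, H i j = ∑ i ∈ S, H i j' := by
  have key : ∀ j, ∑ i ∈ S, H i j = ∑ i ∈ S, H i 0 := by
    intro j
    refine Fin.cases rfl (fun j' => ?_) j
    have := h j'
    rw [Finset.sum_sub_distrib, sub_eq_zero] at this
    exact_mod_cast this
  rw [key j, key j']

lemma main_aux (p k m : ℕ) (hk : 0 < k)
    (H : Matrix (Fin m) (Fin (p + 1)) ℕ) (hent : ∀ i j, H i j ≤ k) (hH : IsIrred H) :
    m ≤ 2 ∨ 2 * (m : ℝ) ≤ (((k : ℝ) / 2) ^ p * (Real.sqrt ((p + 2 : ℕ) : ℝ)) ^ (p + 2)) *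
      (((k : ℝ) + 1) ^ (p + 1) - (k : ℝ) ^ (p + 1)) := by
  classical
  let f : Fin m → (Fin (p + 1) → ℤ) := fun i => psi (fun j => (H i j : ℤ))
  have hf : ∀ i (j : Fin p), f i j.succ = (H i j.succ : ℤ) - (H i 0 : ℤ) := by
    intro i j; simp [f, psi]
  let T : Finset (Fin (p + 1) → ℤ) := Finset.univ.image f
  have hfT : ∀ i, f i ∈ T := fun i => Finset.mem_image_of_mem _ (Finset.mem_univ i)
  let x : (Fin (p + 1) → ℤ) → ℕ := fun v => (Finset.univ.filter (fun i => f i = v)).card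
  have hTD : (T : Set (Fin (p + 1) → ℤ)) ⊆ DD p k := by
    intro v hv
    obtain ⟨i, -, rfl⟩ := Finset.mem_image.1 (Finset.mem_coe.1 hv)
    exact ⟨_, fun j => ⟨by positivity, by exact_mod_cast hent i j⟩, rfl⟩
  have hxsum : ∀ g : (Fin (p + 1) → ℤ) → ℝ, ∑ v ∈ T, (x v : ℝ) * g v = ∑ i, g (f i) := by
    intro g
    rw [← Finset.sum_fiberwise_of_maps_to (s := Finset.univ) (t := T) (g := f) (fun i _ => hfT i)]
    refine Finset.sum_congr rfl fun v _ => ?_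
    rw [Finset.sum_congr rfl (g := fun _ => g v)
      (fun i hi => by rw [(Finset.mem_filter.1 hi).2])]
    simp [x]
  have hx1 : ∑ v ∈ T, (x v : ℝ) = m := by
    have := hxsum (fun _ => 1)
    simpa using this
  have hirr : ∀ r : (Fin (p + 1) → ℤ) → ℕ, (∀ v ∈ T, r v ≤ x v) → (∃ v ∈ T, r v ≠ 0) →
      (∀ j : Fin p, ∑ v ∈ T, (r v : ℝ) * (v j.succ : ℝ) = 0) →
      ∑ v ∈ T, (x v : ℝ) ≤ ∑ v ∈ T, (r v : ℝ) := by
    intro r hrx hr0 hrel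
    have hch : ∀ v, ∃ A : Finset (Fin m), v ∈ T →
        A ⊆ Finset.univ.filter (fun i => f i = v) ∧ A.card = r v := by
      intro v
      by_cases hv : v ∈ T
      · obtain ⟨A, hA⟩ := Finset.exists_subset_card_eq (hrx v hv)
        exact ⟨A, fun _ => hA⟩
      · exact ⟨∅, fun h => absurd h hv⟩
    choose A hA using hch
    let S : Finset (Fin m) := Finset.univ.filter (fun i => i ∈ A (f i))
    have hfib : ∀ v ∈ T, S.filter (fun i => f i = v) = A v := by
      intro v hv
      ext i
      simp only [S, Finset.mem_filter, Finset.mem_univ, true_and]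
      constructor
      · rintro ⟨h1, rfl⟩; exact h1
      · intro h
        have h1 := (Finset.mem_filter.1 ((hA v hv).1 h)).2
        subst h1
        exact ⟨h, rfl⟩
    have hsum : ∀ g : (Fin (p + 1) → ℤ) → ℝ, ∑ v ∈ T, (r v : ℝ) * g v = ∑ i ∈ S, g (f i) := by
      intro g
      rw [← Finset.sum_fiberwise_of_maps_to (s := S) (t := T) (g := f) (fun i _ => hfT i)]
      refine Finset.sum_congr rfl fun v hv => ?_
      rw [Finset.sum_congr rfl (g := fun _ => g v)
        (fun i hi => by rw [(Finset.mem_filter.1 hi).2]), hfib v hv]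
      simp [(hA v hv).2]
    have hcard : ∑ v ∈ T, (r v : ℝ) = S.card := by
      have := hsum (fun _ => 1)
      simpa using this
    have hSne : S.Nonempty := by
      obtain ⟨v, hv, hrv⟩ := hr0
      have h1 : (A v).card ≠ 0 := by rw [(hA v hv).2]; exact hrv
      obtain ⟨i, hi⟩ := Finset.card_ne_zero.1 h1
      rw [← hfib v hv] at hi
      exact ⟨i, (Finset.mem_filter.1 hi).1⟩
    have hSu : S = Finset.univ := by
      refine irred_eq_univ hH S hSne (level_of_succ H S fun j => ?_)
      have h1 := hsum (fun v => (v j.succ : ℝ))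
      rw [hrel j] at h1
      simp only [hf] at h1
      exact_mod_cast h1.symm
    rw [hcard, hSu, hx1]; simp
  have hxrel : ∀ j : Fin p, ∑ v ∈ T, (x v : ℝ) * (v j.succ : ℝ) = 0 := by
    intro j
    rw [hxsum (fun v => (v j.succ : ℝ))]
    simp only [hf]
    have h1 := hH.1 j.succ 0
    have h2 : ((∑ i, H i j.succ : ℕ) : ℝ) = ((∑ i, H i 0 : ℕ) : ℝ) := by rw [h1]
    push_cast at h2 ⊢
    rw [Finset.sum_sub_distrib, h2, sub_self]
  have hm := total_bound p k hk T hTD x hirr T.card (fun v => (x v : ℝ))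
    (fun v _ => by positivity) (fun v _ => le_rfl) hxrel (Finset.card_filter_le _ _)
  rw [hx1] at hm
  let ng : (Fin (p + 1) → ℤ) → (Fin (p + 1) → ℤ) := fun v => Fin.cons (v 0) (fun j => - v j.succ)
  have hng : Function.Injective ng := by
    intro a b h
    funext j
    refine Fin.cases ?_ (fun j' => ?_) j
    · have := congrFun h 0
      simpa [ng] using this
    · have := congrFun h j'.succ
      simpa [ng] using this
  by_cases hdis : Disjoint T (T.image ng)
  · right
    obtain ⟨D, hD, hDc⟩ := DD_finset p k
    have hsub : T ∪ T.image ng ⊆ D := by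
      apply Finset.union_subset
      · exact fun v hv => hD (hTD hv)
      · intro w hw
        obtain ⟨v, hv, rfl⟩ := Finset.mem_image.1 hw
        obtain ⟨u, hu, rfl⟩ := hTD hv
        apply hD
        refine ⟨fun j => k - u j, fun j => ?_, ?_⟩
        · have := hu j
          constructor <;> simp only <;> omega
        · funext j
          refine Fin.cases ?_ (fun j' => ?_) j <;> simp [psi, ng]
    have h1 := Finset.card_le_card hsub
    rw [Finset.card_union_of_disjoint hdis, Finset.card_image_of_injective _ hng] at h1
    have h2 : 2 * (T.card : ℝ) ≤ D.card := by
      have : 2 * T.card ≤ D.card := by omega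
      exact_mod_cast this
    calc 2 * (m : ℝ) ≤ 2 * ((((k : ℝ) / 2) ^ p * (Real.sqrt ((p + 2 : ℕ) : ℝ)) ^ (p + 2)) * T.card) := by
          linarith
      _ = (((k : ℝ) / 2) ^ p * (Real.sqrt ((p + 2 : ℕ) : ℝ)) ^ (p + 2)) * (2 * T.card) := by ring
      _ ≤ _ := by
          apply mul_le_mul_of_nonneg_left (h2.trans hDc)
          positivity
  · left
    rw [Finset.not_disjoint_iff] at hdis
    obtain ⟨v, hv, hv2⟩ := hdis
    obtain ⟨i, -, hi⟩ := Finset.mem_image.1 hv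
    obtain ⟨w, hw, hwv⟩ := Finset.mem_image.1 hv2
    obtain ⟨i', -, hi'⟩ := Finset.mem_image.1 hw
    have hrel : ∀ j : Fin p, ((H i j.succ : ℤ) - (H i 0 : ℤ)) = - ((H i' j.succ : ℤ) - (H i' 0 : ℤ)) := by
      intro j
      rw [← hf, ← hf, hi, hi', ← hwv]
      simp [ng]
    have hu : ({i, i'} : Finset (Fin m)) = Finset.univ := by
      refine irred_eq_univ hH _ ⟨i, by simp⟩ (level_of_succ H _ fun j => ?_)
      have h1 := hrel j
      by_cases hii : i = i'
      · subst hii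
        simp only [Finset.mem_singleton, Finset.insert_eq_of_mem, Finset.sum_singleton]
        omega
      · rw [Finset.sum_pair hii, h1]; ring
    have h1 := congrArg Finset.card hu
    have h2 : ({i, i'} : Finset (Fin m)).card ≤ 2 := Finset.card_le_two
    rw [h1] at h2
    simpa using h2

/-- If `H` is an irreducible level `k`-matrix with `n > 1` columns and `m` rows, then
`m ≤ k^(n−1)·2^(−n)·(n+1)^((n+1)/2)·((k+1)^n − k^n + 1)`. -/
theorem first_upper_bound (n k m : ℕ) (hn : 1 < n) (hk : 0 < k)
    (H : Matrix (Fin m) (Fin n) ℕ) (hent : ∀ i j, H i j ≤ k) (hH : IsIrred H) :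
    (m : ℝ) ≤ (k : ℝ) ^ (n - 1) * (2 : ℝ) ^ (-(n : ℤ)) *
      ((n : ℝ) + 1) ^ (((n : ℝ) + 1) / 2) * (((k : ℝ) + 1) ^ n - (k : ℝ) ^ n + 1) := by
  obtain ⟨p, rfl⟩ : ∃ p, n = p + 1 := ⟨n - 1, by omega⟩
  have hp : 1 ≤ p := by omega
  have hk1 : (1 : ℝ) ≤ k := by exact_mod_cast hk
  set Q : ℝ := (Real.sqrt ((p + 2 : ℕ) : ℝ)) ^ (p + 2) with hQ
  have hpow : (((p + 1 : ℕ) : ℝ) + 1) ^ ((((p + 1 : ℕ) : ℝ) + 1) / 2) = Q := by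
    rw [hQ, Real.sqrt_eq_rpow, ← Real.rpow_natCast, ← Real.rpow_mul (by positivity)]
    push_cast
    congr 1
    · ring
    · ring
  have hN : 3 ≤ ((k : ℝ) + 1) ^ (p + 1) - (k : ℝ) ^ (p + 1) := by
    obtain ⟨q, rfl⟩ : ∃ q, p = q + 1 := ⟨p - 1, by omega⟩
    have h1 : (1 : ℝ) ≤ (k : ℝ) ^ q := one_le_pow₀ hk1
    have h2 : (k : ℝ) ^ q ≤ ((k : ℝ) + 1) ^ q := by gcongr; linarith
    have e1 : ((k : ℝ) + 1) ^ (q + 1 + 1) = ((k : ℝ) + 1) ^ q * ((k : ℝ) + 1) ^ 2 := by ring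
    have e2 : (k : ℝ) ^ (q + 1 + 1) = (k : ℝ) ^ q * (k : ℝ) ^ 2 := by ring
    rw [e1, e2]
    have h3 : (k : ℝ) ^ q * ((k : ℝ) + 1) ^ 2 ≤ ((k : ℝ) + 1) ^ q * ((k : ℝ) + 1) ^ 2 := by gcongr
    nlinarith
  rw [hpow]
  have hC : (k : ℝ) ^ (p + 1 - 1) * (2 : ℝ) ^ (-((p + 1 : ℕ) : ℤ)) * Q = (((k : ℝ) / 2) ^ p * Q) / 2 := by
    rw [zpow_neg, zpow_natCast, div_pow, pow_succ]
    simp only [Nat.add_sub_cancel]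
    field_simp
  rw [hC]
  have hQ0 : 0 ≤ Q := by positivity
  have hCk : 0 ≤ ((k : ℝ) / 2) ^ p * Q := by positivity
  rcases main_aux p k m hk H hent hH with h | h
  · have hm : (m : ℝ) ≤ 2 := by exact_mod_cast h
    have hQ2 : (2 : ℝ) ^ p ≤ Q := by
      rcases Nat.lt_or_ge p 2 with h2 | h2
      · have : p = 1 := by omega
        subst this
        rw [hQ]
        have h3 : (Real.sqrt ((1 + 2 : ℕ) : ℝ)) ^ 2 = 3 := by
          rw [Real.sq_sqrt (by positivity)]; norm_num
        have h4 : 0 ≤ Real.sqrt ((1 + 2 : ℕ) : ℝ) := Real.sqrt_nonneg _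
        have h5 : 1 ≤ Real.sqrt ((1 + 2 : ℕ) : ℝ) := by nlinarith
        calc (2 : ℝ) ^ 1 ≤ 3 * 1 := by norm_num
          _ ≤ (Real.sqrt ((1 + 2 : ℕ) : ℝ)) ^ 2 * Real.sqrt ((1 + 2 : ℕ) : ℝ) := by
              rw [h3]; linarith
          _ = _ := by ring
      · have h3 : (2 : ℝ) ≤ Real.sqrt ((p + 2 : ℕ) : ℝ) := by
          apply Real.le_sqrt_of_sq_le
          push_cast
          have : (2 : ℝ) ≤ p := by exact_mod_cast h2
          linarith
        calc (2 : ℝ) ^ p ≤ 2 ^ (p + 2) := by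
              apply pow_le_pow_right₀ <;> simp
          _ ≤ Q := by rw [hQ]; gcongr
    have h1 : 1 ≤ ((k : ℝ) / 2) ^ p * Q := by
      calc (1 : ℝ) = (1 / 2) ^ p * 2 ^ p := by rw [← mul_pow]; norm_num
        _ ≤ ((k : ℝ) / 2) ^ p * Q := by gcongr
    nlinarith
  · nlinarith
end

section
/- Let S be a finite set with n ≥ 2 elements, let F be a finite index set, and let α be a function from F to the nonempty subsets of S. Suppose (F, α) is a level family of S with height λ, i.e., λ is a positive integer such that every x ∈ S belongs to α(f) for exactly λ indices f ∈ F, and suppose (F, α) is irreducible, i.e., there is no subset F' ⊆ F and integer λ' with 0 < λ' < λ such that every x ∈ S belongs to α(f) for exactly λ' indices f ∈ F'. Then, as real numbers, |F| ≤ (n+1)^{(n+1)/2}. -/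
section
open Finset

lemma hadamard_fin (n : ℕ) (A : Matrix (Fin n) (Fin n) ℝ) (c : ℝ)
    (h : ∀ i, ∑ j, (A i j)^2 ≤ c) : |A.det| ≤ (√c)^n := by
  let b := EuclideanSpace.basisFun (Fin n) ℝ
  have : Fact (Module.finrank ℝ (EuclideanSpace ℝ (Fin n)) = n) := ⟨by simp⟩
  let v : Fin n → EuclideanSpace ℝ (Fin n) := fun i => WithLp.toLp 2 (A i)
  let o := b.toBasis.orientation
  have h1 := o.abs_volumeForm_apply_le v
  rw [o.volumeForm_robust b rfl] at h1
  have h2 : b.toBasis.det v = A.det := by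
    rw [Module.Basis.det_apply, ← Matrix.det_transpose]
    congr 1
  rw [h2] at h1
  refine h1.trans ?_
  calc ∏ i, ‖v i‖ ≤ ∏ i : Fin n, √c := by
        refine Finset.prod_le_prod (fun _ _ => norm_nonneg _) fun i _ => ?_
        rw [EuclideanSpace.norm_eq]
        apply Real.sqrt_le_sqrt
        simpa [v] using h i
    _ = _ := by simp

lemma hadamard_gen {ι : Type*} [Fintype ι] [DecidableEq ι] (A : Matrix ι ι ℝ) (c : ℝ)
    (h : ∀ i, ∑ j, (A i j)^2 ≤ c) : |A.det| ≤ (√c)^(Fintype.card ι) := by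
  let e := Fintype.equivFin ι
  rw [← Matrix.det_reindex_self e A]
  apply hadamard_fin
  intro i
  refine le_trans (le_of_eq ?_) (h (e.symm i))
  simp only [Matrix.reindex_apply, Matrix.submatrix_apply]
  exact Equiv.sum_comp e.symm (fun j => (A (e.symm i) j)^2)

lemma bordered_bound {S : Type*} [Fintype S] [DecidableEq S] (B : Matrix S S ℝ)
    (hB : ∀ i j, B i j = 0 ∨ B i j = 1) (hS : 0 < Fintype.card S) :
    |(Matrix.fromBlocks B (Matrix.of fun _ (_ : Unit) => (1:ℝ)) (Matrix.of fun _ _ => 1) 0).det| * 2 ^ (Fintype.card S - 1)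
      ≤ (√((Fintype.card S : ℝ) + 1)) ^ (Fintype.card S + 1) := by
  set M := Matrix.fromBlocks B (Matrix.of fun _ (_ : Unit) => (1:ℝ)) (Matrix.of fun _ _ => 1) 0 with hM
  let Q : Matrix (S ⊕ Unit) (S ⊕ Unit) ℝ :=
    Matrix.fromBlocks ((2:ℝ) • 1) 0 (Matrix.of fun _ _ => -1) 1
  let P : Matrix (S ⊕ Unit) (S ⊕ Unit) ℝ :=
    Matrix.fromBlocks 1 0 0 ((2⁻¹:ℝ) • 1)
  let N : Matrix (S ⊕ Unit) (S ⊕ Unit) ℝ :=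
    Matrix.fromBlocks (Matrix.of fun i j => 2 * B i j - 1) (Matrix.of fun _ _ => 1) (Matrix.of fun _ _ => 1) 0
  have hPQ : P * M * Q = N := by
    simp only [P, hM, Q, N, Matrix.fromBlocks_multiply]
    congr 1 <;> ext i j <;> simp [Matrix.mul_apply] <;> ring
  have hP : P.det = 2⁻¹ := by simp [P]
  have hQ : Q.det = 2 ^ Fintype.card S := by simp [Q, Matrix.det_smul]
  have hN : |N.det| ≤ (√((Fintype.card S : ℝ) + 1)) ^ (Fintype.card (S ⊕ Unit)) := by
    apply hadamard_gen
    rintro (i | i)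
    · have : ∀ j, (2 * B i j - 1)^2 = 1 := fun j => by
        rcases hB i j with h | h <;> rw [h] <;> norm_num
      simp [N, Fintype.sum_sum_type, this]
    · simp [N, Fintype.sum_sum_type]
  rw [← hPQ, Matrix.det_mul, Matrix.det_mul, hP, hQ, abs_mul, abs_mul] at hN
  simp only [Fintype.card_sum, Fintype.card_unit] at hN
  refine le_trans (le_of_eq ?_) hN
  obtain ⟨k, hk⟩ := Nat.exists_eq_succ_of_ne_zero hS.ne'
  rw [hk]
  simp [pow_succ, abs_of_pos]
  ring

/-- indicator vector of a set -/
def chiv {S : Type*} [DecidableEq S] (A : Finset S) (x : S) : ℝ := if x ∈ A then 1 else 0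

lemma circuit_integral {S : Type*} [Fintype S] [DecidableEq S] (hS : 0 < Fintype.card S)
    (y : Finset S → ℝ) (hy0 : ∀ A, 0 ≤ y A)
    (hlev : ∀ x, ∑ A, y A * chiv A x = 1)
    (hli : ∀ d : Finset S → ℝ, (∀ A, y A = 0 → d A = 0) → (∀ x, ∑ A, d A * chiv A x = 0) → d = 0) :
    ∃ (v : Finset S → ℕ) (h : ℕ), 0 < h ∧ (∀ A, (v A : ℝ) = h * y A) ∧
      (∑ A, (v A : ℝ)) * 2 ^ (Fintype.card S - 1) ≤ (√((Fintype.card S : ℝ) + 1)) ^ (Fintype.card S + 1) := by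
  have hind : LinearIndepOn ℝ (chiv : Finset S → S → ℝ) {A | y A ≠ 0} := by
    rw [linearIndepOn_iff]
    intro l hl h0
    have hd := hli l (fun A hA => by
      by_contra hne
      have : A ∈ {A | y A ≠ 0} := (Finsupp.mem_supported _ _).1 hl (by simpa using hne)
      exact this hA) (fun x => by
        have := congrFun h0 x
        rw [Finsupp.linearCombination_apply, Finsupp.sum_fintype _ _ (by simp)] at this
        simpa [Finset.sum_apply] using this)
    ext A
    exact congrFun hd A
  obtain ⟨b, -, hsb, hspan, hb⟩ := exists_linearIndepOn_extension hind (Set.subset_univ _)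
  have htop : Submodule.span ℝ ((chiv : Finset S → S → ℝ) '' b) = ⊤ := by
    rw [eq_top_iff, ← (Pi.basisFun ℝ S).span_eq, Submodule.span_le]
    rintro _ ⟨s, rfl⟩
    apply hspan
    refine ⟨{s}, trivial, ?_⟩
    ext x
    simp [chiv, Pi.single_apply]
  have : Fintype b := Fintype.ofFinite b
  let bas : Module.Basis b ℝ (S → ℝ) := Module.Basis.mk hb (by
    rw [← htop, Set.image_eq_range])
  have hcard : Fintype.card S = Fintype.card b := by
    rw [← Module.finrank_eq_card_basis bas, Module.finrank_fintype_fun_eq_card]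
  let e : S ≃ b := Fintype.equivOfCardEq hcard
  let BZ : Matrix S S ℤ := Matrix.of fun x s => if x ∈ (e s : Finset S) then 1 else 0
  let B : Matrix S S ℝ := BZ.map (Int.cast)
  have hBe : ∀ x s, B x s = chiv (e s : Finset S) x := fun x s => by
    simp [B, BZ, chiv]
  have hunit : IsUnit B := by
    rw [← Matrix.linearIndependent_cols_iff_isUnit]
    have : B.col = fun s => chiv ((e s : b) : Finset S) := by
      ext s x; exact hBe x s
    rw [this]
    exact hb.comp e e.injective
  have hdet : IsUnit B.det := (Matrix.isUnit_iff_isUnit_det B).1 hunit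
  -- sums
  have hsum : ∀ g : Finset S → ℝ, (∀ A, y A = 0 → g A = 0) → ∑ A, g A = ∑ s, g (e s) := by
    intro g hg
    rw [Equiv.sum_comp e (fun A : b => g A)]
    symm
    apply Finset.sum_of_injOn (fun A : b => (A : Finset S))
    · exact Subtype.val_injective.injOn
    · simp
    · intro A _ hA
      apply hg
      by_contra hne
      exact hA ⟨⟨A, hsb hne⟩, by simp⟩
    · simp
  have hBy : B.mulVec (fun s => y (e s)) = fun _ => 1 := by
    ext x
    rw [← hlev x, hsum _ (fun A hA => by simp [hA])]
    simp [Matrix.mulVec, dotProduct, hBe, mul_comm]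
  have hdetc : B.det = (BZ.det : ℝ) := by
    simp [B, Int.cast_det]
  have hcr : ∀ s, (BZ.cramer (fun _ => 1) s : ℝ) = BZ.det * y (e s) := by
    intro s
    have h1 : B.mulVec (fun s => (BZ.cramer (fun _ => 1) s : ℝ)) = B.mulVec (fun s => BZ.det * y (e s)) := by
      have h2 : B.mulVec (fun s => BZ.det * y (e s)) = (BZ.det : ℝ) • B.mulVec (fun s => y (e s)) := by
        rw [← Matrix.mulVec_smul]; rfl
      rw [h2, hBy]
      ext x
      have h3 := congrFun (Matrix.mulVec_cramer BZ (fun _ => 1)) x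
      have h4 : ((BZ.mulVec (BZ.cramer (fun _ => 1)) x : ℤ) : ℝ) = BZ.det := by rw [h3]; simp
      simp only [Pi.smul_apply, smul_eq_mul, mul_one]
      rw [← h4]
      simp [Matrix.mulVec, dotProduct, B]
    exact congrFun (Matrix.mulVec_injective_of_isUnit hunit h1) s
  have hex : ∀ A, ∃ k : ℕ, (k : ℝ) = (BZ.det.natAbs : ℕ) * y A := by
    intro A
    by_cases hA : y A = 0
    · exact ⟨0, by simp [hA]⟩
    · refine ⟨(BZ.cramer (fun _ => 1) (e.symm ⟨A, hsb hA⟩)).natAbs, ?_⟩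
      have := hcr (e.symm ⟨A, hsb hA⟩)
      simp only [Equiv.apply_symm_apply] at this
      rw [Nat.cast_natAbs, Nat.cast_natAbs, Int.cast_abs, Int.cast_abs, this, abs_mul, abs_of_nonneg (hy0 A)]
  choose v hv using hex
  refine ⟨v, BZ.det.natAbs, ?_, hv, ?_⟩
  · rw [Int.natAbs_pos]
    intro h0
    rw [hdetc, h0] at hdet
    simp at hdet
  refine le_trans (le_of_eq ?_) (bordered_bound B (fun i j => by
    rw [hBe]; unfold chiv; split_ifs <;> simp) hS)
  congr 1
  have : Invertible B := hunit.invertible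
  rw [Matrix.det_fromBlocks₁₁]
  have hcol : ⅟B * (Matrix.of fun _ _ => (1:ℝ) : Matrix S Unit ℝ) = (Matrix.of fun s _ => y (e s) : Matrix S Unit ℝ) := by
    have : (Matrix.of fun _ _ => (1:ℝ) : Matrix S Unit ℝ) = B * (Matrix.of fun s _ => y (e s) : Matrix S Unit ℝ) := by
      ext x u
      have := congrFun hBy x
      simp only [Matrix.mulVec, dotProduct] at this
      simp [Matrix.mul_apply, this]
    rw [this, Matrix.invOf_mul_cancel_left]
  rw [Matrix.mul_assoc, hcol]
  rw [hsum _ (fun A hA => by rw [hv, hA, mul_zero])]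
  have h5 : (0 - (Matrix.of fun _ _ => (1:ℝ) : Matrix Unit S ℝ) * (Matrix.of fun s _ => y (e s) : Matrix S Unit ℝ)).det
      = - ∑ s, y (e s) := by
    simp [Matrix.det_unique, Matrix.mul_apply]
  rw [h5, abs_mul, abs_neg, abs_of_nonneg (Finset.sum_nonneg fun s _ => hy0 _), Finset.mul_sum]
  refine Finset.sum_congr rfl fun s _ => ?_
  rw [hv, hdetc, Nat.cast_natAbs, Int.cast_abs]

/-- killing a coordinate -/
lemma kill_coord {T : Type*} [Fintype T] [DecidableEq T] (w d : T → ℝ) (hw : ∀ A, 0 ≤ w A)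
    (hd : ∀ A, w A = 0 → d A = 0) (hpos : ∃ A, 0 < d A) :
    ∃ c : ℝ, 0 < c ∧ (∀ A, 0 ≤ w A - c * d A) ∧
      (univ.filter fun A => w A - c * d A ≠ 0) ⊂ (univ.filter fun A => w A ≠ 0) := by
  obtain ⟨A₁, hA₁⟩ := hpos
  obtain ⟨A₀, hA₀, hmin⟩ := Finset.exists_min_image (univ.filter fun A => 0 < d A) (fun A => w A / d A)
    ⟨A₁, by simpa using hA₁⟩
  simp only [mem_filter, mem_univ, true_and] at hA₀ hmin
  have hw0 : w A₀ ≠ 0 := fun h => hA₀.ne' (hd _ h)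
  refine ⟨w A₀ / d A₀, div_pos (lt_of_le_of_ne (hw _) hw0.symm) hA₀, ?_, ?_⟩
  · intro A
    by_cases hA : 0 < d A
    · have := hmin A hA
      rw [le_div_iff₀ hA] at this
      linarith
    · have : w A₀ / d A₀ * d A ≤ 0 :=
        mul_nonpos_of_nonneg_of_nonpos (div_nonneg (hw _) hA₀.le) (not_lt.1 hA)
      linarith [hw A]
  · rw [Finset.ssubset_iff_of_subset]
    · refine ⟨A₀, by simpa using hw0, ?_⟩
      simp [div_mul_cancel₀ _ hA₀.ne']
    · intro A
      simp only [mem_filter, mem_univ, true_and]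
      intro h h0
      exact h (by rw [h0, hd A h0]; simp)

lemma exists_circuit_s15 {S : Type*} [Fintype S] [DecidableEq S] (k : ℕ) :
    ∀ (w : Finset S → ℝ), (univ.filter fun A => w A ≠ 0).card ≤ k → (∀ A, 0 ≤ w A) →
    (∀ x, ∑ A, w A * chiv A x = 1) →
    ∃ y : Finset S → ℝ, (∀ A, 0 ≤ y A) ∧ (∀ A, w A = 0 → y A = 0) ∧
      (∀ x, ∑ A, y A * chiv A x = 1) ∧
      (∀ d : Finset S → ℝ, (∀ A, y A = 0 → d A = 0) → (∀ x, ∑ A, d A * chiv A x = 0) → d = 0) := by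
  induction k with
  | zero =>
    intro w hk hw hlev
    refine ⟨w, hw, fun _ h => h, hlev, fun d hd _ => ?_⟩
    ext A
    apply hd
    by_contra hne
    have : A ∈ (univ.filter fun A => w A ≠ 0) := by simpa using hne
    rw [Finset.card_eq_zero.1 (Nat.le_zero.1 hk)] at this
    simp at this
  | succ k ih =>
    intro w hk hw hlev
    by_cases hli : (∀ d : Finset S → ℝ, (∀ A, w A = 0 → d A = 0) → (∀ x, ∑ A, d A * chiv A x = 0) → d = 0)
    · exact ⟨w, hw, fun _ h => h, hlev, hli⟩
    push Not at hli
    obtain ⟨d, hd, hd0, hne⟩ := hli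
    have : ∃ d : Finset S → ℝ, (∀ A, w A = 0 → d A = 0) ∧ (∀ x, ∑ A, d A * chiv A x = 0) ∧ ∃ A, 0 < d A := by
      obtain ⟨A, hA⟩ := Function.ne_iff.1 hne
      rcases lt_or_gt_of_ne hA with h | h
      · exact ⟨fun A => - d A, fun A hA => by simp [hd A hA], fun x => by simp [hd0 x],
          A, by simpa using h⟩
      · exact ⟨d, hd, hd0, A, h⟩
    obtain ⟨d, hd, hd0, hpos⟩ := this
    obtain ⟨c, hc, h1, h2⟩ := kill_coord w d hw hd hpos
    obtain ⟨y, hy1, hy2, hy3, hy4⟩ := ih (fun A => w A - c * d A)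
      (by have := Finset.card_lt_card h2; omega) h1 (fun x => by
        simp only [sub_mul, Finset.sum_sub_distrib, mul_assoc]
        rw [← Finset.mul_sum, hd0, hlev]; simp)
    exact ⟨y, hy1, fun A hA => hy2 A (by simp [hA, hd A hA]), hy3, hy4⟩

lemma decomp_bound {S : Type*} [Fintype S] [DecidableEq S] (hS : 0 < Fintype.card S)
    (m : Finset S → ℕ) (hm0 : m ∅ = 0) (lam : ℕ)
    (hm : ∀ x, ∑ A, (m A : ℝ) * chiv A x = lam)
    (hirr : ∀ (v : Finset S → ℕ) (h : ℕ), 0 < h → (∀ A, v A ≤ m A) →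
      (∀ x, ∑ A, (v A : ℝ) * chiv A x = h) → lam ≤ h) (k : ℕ) :
    ∀ (w : Finset S → ℝ) (t : ℝ), (univ.filter fun A => w A ≠ 0).card ≤ k → (∀ A, 0 ≤ w A) →
      (∀ A, w A ≤ m A) → (∀ x, ∑ A, w A * chiv A x = t) →
      (∑ A, w A) * 2 ^ (Fintype.card S - 1) ≤
        k * (√((Fintype.card S : ℝ) + 1)) ^ (Fintype.card S + 1) := by
  have hpos_of : ∀ (w : Finset S → ℝ), (∀ A, 0 ≤ w A) → w ∅ = 0 → (∃ A, w A ≠ 0) →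
      ∃ x, 0 < ∑ A, w A * chiv A x := by
    rintro w hw h0 ⟨A, hA⟩
    have hAne : A.Nonempty := by
      rw [Finset.nonempty_iff_ne_empty]; rintro rfl; exact hA h0
    obtain ⟨x, hx⟩ := hAne
    refine ⟨x, Finset.sum_pos' (fun B _ => mul_nonneg (hw B) ?_) ⟨A, mem_univ _, ?_⟩⟩
    · unfold chiv; split_ifs <;> norm_num
    · simpa [chiv, hx] using lt_of_le_of_ne (hw A) (Ne.symm hA)
  induction k with
  | zero =>
    intro w t hk hw _ _
    have : ∀ A, w A = 0 := by
      intro A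
      by_contra hne
      have : A ∈ (univ.filter fun A => w A ≠ 0) := by simpa using hne
      rw [Finset.card_eq_zero.1 (Nat.le_zero.1 hk)] at this
      simp at this
    simp [this]
  | succ k ih =>
    intro w t hk hw hwm hlev
    set K := (√((Fintype.card S : ℝ) + 1)) ^ (Fintype.card S + 1) with hK
    have hK0 : 0 ≤ K := by positivity
    by_cases hz : ∀ A, w A = 0
    · simp only [hz, Finset.sum_const_zero, zero_mul]; positivity
    push Not at hz
    have hw0 : w ∅ = 0 := le_antisymm (by simpa [hm0] using hwm ∅) (hw ∅)
    obtain ⟨x₀, hx₀⟩ := hpos_of w hw hw0 hz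
    have ht : 0 < t := by rwa [hlev] at hx₀
    obtain ⟨y, hy1, hy2, hy3, hy4⟩ := exists_circuit_s15 _ (fun A => t⁻¹ * w A) le_rfl
      (fun A => mul_nonneg (inv_nonneg.2 ht.le) (hw A))
      (fun x => by simp only [mul_assoc]; rw [← Finset.mul_sum, hlev, inv_mul_cancel₀ ht.ne'])
    obtain ⟨v, h, hh, hv, hvK⟩ := circuit_integral hS y hy1 hy3 hy4
    have hvlev : ∀ x, ∑ A, (v A : ℝ) * chiv A x = h := fun x => by
      simp only [hv, mul_assoc]; rw [← Finset.mul_sum, hy3, mul_one]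
    have hvw : ∀ A, w A = 0 → (v A : ℝ) = 0 := fun A hA => by
      rw [hv, hy2 A (by simp [hA]), mul_zero]
    have hvpos : ∃ A, 0 < (v A : ℝ) := by
      by_contra hcon
      push Not at hcon
      have := hvlev x₀
      have h2 : ∀ A, (v A : ℝ) = 0 := fun A => le_antisymm (hcon A) (Nat.cast_nonneg _)
      simp only [h2, zero_mul, Finset.sum_const_zero] at this
      exact hh.ne (by exact_mod_cast this)
    obtain ⟨c, hc, h1, h2⟩ := kill_coord w (fun A => (v A : ℝ)) hw hvw hvpos
    have hcv : ∀ A, c * v A ≤ w A := fun A => by linarith [h1 A]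
    by_cases hc1 : c ≤ 1
    · have := ih (fun A => w A - c * v A) (t - c * h)
        (by have := Finset.card_lt_card h2; omega) h1
        (fun A => by
          have : 0 ≤ c * (v A : ℝ) := by positivity
          linarith [hwm A])
        (fun x => by
          simp only [sub_mul, Finset.sum_sub_distrib, mul_assoc]
          rw [← Finset.mul_sum, hvlev, hlev])
      rw [Finset.sum_sub_distrib, ← Finset.mul_sum] at this
      have h3 : c * ((∑ A, (v A : ℝ)) * 2 ^ (Fintype.card S - 1)) ≤ 1 * K :=
        mul_le_mul hc1 hvK (by positivity) zero_le_one
      push_cast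
      linarith
    · push Not at hc1
      have hvm : ∀ A, v A ≤ m A := fun A => by
        have h3 : (v A : ℝ) ≤ m A := by
          have : (v A : ℝ) ≤ c * v A := le_mul_of_one_le_left (Nat.cast_nonneg _) hc1.le
          linarith [hcv A, hwm A]
        exact_mod_cast h3
      have hlh := hirr v h hh hvm hvlev
      have hmv : ∀ A, (m A : ℝ) - v A = 0 := by
        by_contra hcon
        push Not at hcon
        obtain ⟨x, hx⟩ := hpos_of (fun A => (m A : ℝ) - v A)
          (fun A => by have := hvm A; simpa using this)
          (by have := hvm ∅; rw [hm0] at this; simp [hm0, Nat.le_zero.1 this]) hcon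
        simp only [sub_mul, Finset.sum_sub_distrib] at hx
        rw [hm, hvlev] at hx
        have : (lam : ℝ) ≤ h := by exact_mod_cast hlh
        linarith
      have h4 : ∑ A, w A ≤ ∑ A, (v A : ℝ) :=
        Finset.sum_le_sum fun A _ => by linarith [hmv A, hwm A]
      have h5 := mul_le_mul_of_nonneg_right h4 (by positivity : (0:ℝ) ≤ 2 ^ (Fintype.card S - 1))
      push_cast
      have : 0 ≤ (k : ℝ) * K := by positivity
      linarith


/-- If `S` is a finite set with `n ≥ 2` elements and `(F, α)` is an irreducible level family of
`S` with height `lam` (each `x ∈ S` lies in `α f` for exactly `lam` indices `f`, and no subset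
`F' ⊆ F` is a level family of some smaller positive height `lam'`), then
`|F| ≤ (n+1)^((n+1)/2)`. -/
theorem irreducible_family_card_le (S : Type*) [Fintype S] (n : ℕ) (hn : 2 ≤ n)
    (hS : Fintype.card S = n)
    (F : Type*) [Fintype F] (α : F → Finset S) (hne : ∀ f, (α f).Nonempty)
    (lam : ℕ) (hlam : 0 < lam)
    (hlevel : ∀ x : S, Nat.card {f : F // x ∈ α f} = lam)
    (hirr : ¬ ∃ (F' : Finset F) (lam' : ℕ), 0 < lam' ∧ lam' < lam ∧
      ∀ x : S, Nat.card {f : F // f ∈ F' ∧ x ∈ α f} = lam') :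
    (Fintype.card F : ℝ) ≤ ((n : ℝ) + 1) ^ (((n : ℝ) + 1) / 2) := by
  classical
  have hcS : 0 < Fintype.card S := by omega
  let m : Finset S → ℕ := fun A => (univ.filter fun f => α f = A).card
  have hfib : ∀ (F' : Finset F) (x : S),
      ∑ A, (((F'.filter fun f => α f = A).card : ℕ) : ℝ) * chiv A x =
        (Nat.card {f : F // f ∈ F' ∧ x ∈ α f} : ℝ) := by
    intro F' x
    have h1 : Nat.card {f : F // f ∈ F' ∧ x ∈ α f} = (F'.filter fun f => x ∈ α f).card := by
      rw [Nat.card_eq_fintype_card]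
      exact Fintype.card_of_subtype _ (by simp)
    rw [h1, Finset.card_eq_sum_card_fiberwise (f := α) (t := univ) (by simp)]
    push_cast
    refine Finset.sum_congr rfl fun A _ => ?_
    unfold chiv
    rw [Finset.filter_filter]
    split_ifs with hx
    · rw [mul_one]
      congr 2
      ext f
      simp only [mem_filter]
      constructor
      · rintro ⟨h, rfl⟩; exact ⟨h, hx, rfl⟩
      · rintro ⟨h, -, h'⟩; exact ⟨h, h'⟩
    · rw [mul_zero]
      symm
      rw [Nat.cast_eq_zero, Finset.card_eq_zero, Finset.filter_eq_empty_iff]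
      rintro f - ⟨h, rfl⟩
      exact hx h
  have hm : ∀ x, ∑ A, (m A : ℝ) * chiv A x = lam := by
    intro x
    rw [← hlevel x]
    have := hfib univ x
    simpa [m] using this
  have hm0 : m ∅ = 0 := by
    simp only [m, Finset.card_eq_zero, Finset.filter_eq_empty_iff]
    intro f _
    exact (hne f).ne_empty
  have hirr' : ∀ (v : Finset S → ℕ) (h : ℕ), 0 < h → (∀ A, v A ≤ m A) →
      (∀ x, ∑ A, (v A : ℝ) * chiv A x = h) → lam ≤ h := by
    intro v h hh hvm hv
    by_contra hlt
    push Not at hlt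
    apply hirr
    choose G hG hGc using fun A => Finset.exists_subset_card_eq (hvm A)
    have hGA : ∀ A f, f ∈ G A → α f = A := fun A f hf => by simpa using hG A hf
    refine ⟨univ.filter fun f => f ∈ G (α f), h, hh, hlt, fun x => ?_⟩
    have h1 := hfib (univ.filter fun f => f ∈ G (α f)) x
    have h2 : ∀ A, ((univ.filter fun f => f ∈ G (α f)).filter fun f => α f = A) = G A := by
      intro A
      ext f
      simp only [mem_filter, mem_univ, true_and]
      constructor
      · rintro ⟨h, rfl⟩; exact h
      · intro hf
        have := hGA A f hf
        exact ⟨by rwa [this], this⟩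
    simp only [h2, hGc] at h1
    rw [hv] at h1
    exact_mod_cast h1.symm
  have hcard : (Fintype.card F : ℝ) = ∑ A, (m A : ℝ) := by
    rw [← Finset.card_univ, Finset.card_eq_sum_card_fiberwise (f := α) (t := univ) (by simp)]
    push_cast
    rfl
  have hKeq : ((n : ℝ) + 1) ^ (((n : ℝ) + 1) / 2) = (√((n : ℝ) + 1)) ^ (n + 1) := by
    rw [Real.sqrt_eq_rpow, ← Real.rpow_natCast, ← Real.rpow_mul (by positivity)]
    congr 1
    push_cast
    ring
  have hle1 : (Fintype.card F : ℝ) ≤ n * lam := by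
    have h1 : ∑ x : S, ∑ A, (m A : ℝ) * chiv A x = n * lam := by
      simp [hm, hS]
    rw [← h1, Finset.sum_comm, hcard]
    refine Finset.sum_le_sum fun A _ => ?_
    rw [← Finset.mul_sum]
    by_cases hA : A = ∅
    · simp [hA, hm0]
    · have h2 : (1 : ℝ) ≤ ∑ x, chiv A x := by
        simp only [chiv, Finset.sum_boole]
        have : 1 ≤ A.card := Finset.card_pos.2 (Finset.nonempty_iff_ne_empty.2 hA)
        simpa using this
      exact le_mul_of_one_le_right (Nat.cast_nonneg _) h2
  have hn2 : (2 : ℝ) ≤ n := by exact_mod_cast hn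
  by_cases hl1 : lam = 1
  · rw [hl1] at hle1
    have h1 : ((n : ℝ) + 1) ^ (1 : ℝ) ≤ ((n : ℝ) + 1) ^ (((n : ℝ) + 1) / 2) :=
      Real.rpow_le_rpow_of_exponent_le (by linarith) (by linarith)
    rw [Real.rpow_one] at h1
    push_cast at hle1
    linarith
  have hcompl : ∀ A, m A ≠ 0 → m Aᶜ = 0 := by
    intro A hA
    by_contra hA'
    have : Nonempty S := Fintype.card_pos_iff.1 hcS
    have hAA : A ≠ Aᶜ := fun h => by
      obtain ⟨x⟩ := this
      have := Finset.mem_compl (s := A) (a := x)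
      rw [← h] at this
      tauto
    have := hirr' (fun B => if B = A ∨ B = Aᶜ then 1 else 0) 1 one_pos (fun B => by
      split_ifs with h
      · rcases h with rfl | rfl <;> omega
      · exact Nat.zero_le _) (fun x => by
      have : ∀ B, (((if B = A ∨ B = Aᶜ then 1 else 0 : ℕ)) : ℝ) * chiv B x
          = (if B = A then chiv A x else 0) + (if B = Aᶜ then chiv Aᶜ x else 0) := by
        intro B
        by_cases h1 : B = A
        · subst h1; simp [hAA]
        · by_cases h2 : B = Aᶜ
          · subst h2; simp [h1]
          · simp [h1, h2]
      simp only [this, Finset.sum_add_distrib, Finset.sum_ite_eq', mem_univ, if_true]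
      by_cases hx : x ∈ A <;> simp [chiv, hx])
    omega
  have hsupp : (univ.filter fun A => (m A : ℝ) ≠ 0).card ≤ 2 ^ (n - 1) := by
    set T := univ.filter fun A => (m A : ℝ) ≠ 0 with hT
    have hdis : Disjoint T (T.image compl) := by
      rw [Finset.disjoint_left]
      intro A hA hA'
      obtain ⟨B, hB, rfl⟩ := Finset.mem_image.1 hA'
      simp only [hT, mem_filter, mem_univ, true_and, ne_eq, Nat.cast_eq_zero] at hA hB
      exact hA (hcompl B hB)
    have h1 := Finset.card_le_univ (T ∪ T.image compl)
    rw [Finset.card_union_of_disjoint hdis, Finset.card_image_of_injective _ compl_injective,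
      Fintype.card_finset, hS] at h1
    obtain ⟨k, rfl⟩ : ∃ k, n = k + 1 := ⟨n - 1, by omega⟩
    rw [pow_succ] at h1
    simp only [Nat.add_sub_cancel]
    omega
  have hfinal := decomp_bound hcS m hm0 lam hm hirr' (2 ^ (n - 1)) (fun A => (m A : ℝ)) lam hsupp
    (fun A => Nat.cast_nonneg _) (fun A => le_rfl) hm
  rw [← hcard, hS, ← hKeq] at hfinal
  push_cast at hfinal
  rw [mul_comm] at hfinal
  exact le_of_mul_le_mul_left hfinal (by positivity)

end
end
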